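/- For any finite family of rings R₁, …, R_m, one has l.Gwdim(R₁ × ⋯ × R_m) = sup{l.Gwdim(R_i) : 1 ≤ i ≤ m} and r.Gwdim(R₁ × ⋯ × R_m) = sup{r.Gwdim(R_i) : 1 ≤ i ≤ m}. -/

import Mathlib

/-!
Background definitions for D. Bennis, "Weak Gorenstein global dimensions".

Conventions.  All rings are associative with identity.  A *left* `R`-module is a type with
`[AddCommGroup M] [Module R M]`; a *right* `R`-module is a left module over the opposite ring,
i.e. `[Module Rᵐᵒᵖ M]`.  All "right-handed" notions below are obtained by applying the
corresponding "left-handed" notion to the opposite ring `Rᵐᵒᵖ`.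
-/

open MulOpposite

universe u

section Tensor

variable (S : Type u) [Ring S]

/-- The subgroup of relations defining the tensor product `A ⊗_S M` of a right `S`-module `A`
and a left `S`-module `M` over a (possibly noncommutative) ring `S`. -/
def tensorRels (A : Type u) [AddCommGroup A] [Module Sᵐᵒᵖ A]
    (M : Type u) [AddCommGroup M] [Module S M] :
    AddSubgroup (FreeAbelianGroup (A × M)) :=
  AddSubgroup.closure
    { x | (∃ a₁ a₂ m, x = FreeAbelianGroup.of (a₁ + a₂, m) - FreeAbelianGroup.of (a₁, m) -
            FreeAbelianGroup.of (a₂, m)) ∨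
          (∃ a m₁ m₂, x = FreeAbelianGroup.of (a, m₁ + m₂) - FreeAbelianGroup.of (a, m₁) -
            FreeAbelianGroup.of (a, m₂)) ∨
          (∃ (a : A) (r : S) (m : M), x = FreeAbelianGroup.of (op r • a, m) - FreeAbelianGroup.of (a, r • m)) }

/-- The tensor product `A ⊗_S M` (an abelian group) of a right `S`-module `A` and a left
`S`-module `M` over a (possibly noncommutative) ring `S`. -/
def NTensor (A : Type u) [AddCommGroup A] [Module Sᵐᵒᵖ A]
    (M : Type u) [AddCommGroup M] [Module S M] : Type u :=
  FreeAbelianGroup (A × M) ⧸ tensorRels S A M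

instance (A : Type u) [AddCommGroup A] [Module Sᵐᵒᵖ A]
    (M : Type u) [AddCommGroup M] [Module S M] : AddCommGroup (NTensor S A M) :=
  QuotientAddGroup.Quotient.addCommGroup _

namespace NTensor

variable {S}
variable {A A' : Type u} [AddCommGroup A] [Module Sᵐᵒᵖ A] [AddCommGroup A'] [Module Sᵐᵒᵖ A']
variable {M M' : Type u} [AddCommGroup M] [Module S M] [AddCommGroup M'] [Module S M']

/-- Functoriality of `A ⊗_S −` : the map `A ⊗_S M → A ⊗_S M'` induced by a linear map
`g : M → M'` of left `S`-modules. -/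
def rmap (A : Type u) [AddCommGroup A] [Module Sᵐᵒᵖ A] (g : M →ₗ[S] M') :
    NTensor S A M →+ NTensor S A M' :=
  QuotientAddGroup.map (tensorRels S A M) (tensorRels S A M') (FreeAbelianGroup.map (Prod.map id g)) (by
    simp only [tensorRels]
    refine (AddSubgroup.closure_le _).2 ?_
    rintro x (⟨a₁, a₂, m, rfl⟩ | ⟨a, m₁, m₂, rfl⟩ | ⟨a, r, m, rfl⟩) <;>
      refine SetLike.mem_coe.2 (AddSubgroup.mem_comap.2 (AddSubgroup.subset_closure ?_)) <;>
      simp only [map_sub, map_add, map_smul, FreeAbelianGroup.map_of_apply, Prod.map_apply,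
        id_eq, Set.mem_setOf_eq]
    · exact Or.inl ⟨a₁, a₂, g m, rfl⟩
    · exact Or.inr (Or.inl ⟨a, g m₁, g m₂, rfl⟩)
    · exact Or.inr (Or.inr ⟨a, r, g m, rfl⟩))

/-- Functoriality of `− ⊗_S M` : the map `A ⊗_S M → A' ⊗_S M` induced by a linear map
`f : A → A'` of right `S`-modules. -/
def lmap (M : Type u) [AddCommGroup M] [Module S M] (f : A →ₗ[Sᵐᵒᵖ] A') :
    NTensor S A M →+ NTensor S A' M :=
  QuotientAddGroup.map (tensorRels S A M) (tensorRels S A' M) (FreeAbelianGroup.map (Prod.map f id)) (by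
    simp only [tensorRels]
    refine (AddSubgroup.closure_le _).2 ?_
    rintro x (⟨a₁, a₂, m, rfl⟩ | ⟨a, m₁, m₂, rfl⟩ | ⟨a, r, m, rfl⟩) <;>
      refine SetLike.mem_coe.2 (AddSubgroup.mem_comap.2 (AddSubgroup.subset_closure ?_)) <;>
      simp only [map_sub, map_add, map_smul, FreeAbelianGroup.map_of_apply, Prod.map_apply,
        id_eq, Set.mem_setOf_eq]
    · exact Or.inl ⟨f a₁, f a₂, m, rfl⟩
    · exact Or.inr (Or.inl ⟨f a, m₁, m₂, rfl⟩)
    · exact Or.inr (Or.inr ⟨f a, r, m, rfl⟩))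

end NTensor

end Tensor

section Dims

variable (S : Type u) [Ring S]

/-- A left `S`-module `M` is *flat* if tensoring with it preserves injectivity of maps of
right `S`-modules. -/
def IsFlatMod (M : ModuleCat.{u} S) : Prop :=
  ∀ (A B : Type u) [AddCommGroup A] [Module Sᵐᵒᵖ A] [AddCommGroup B] [Module Sᵐᵒᵖ B]
    (f : A →ₗ[Sᵐᵒᵖ] B), Function.Injective f →
      Function.Injective (NTensor.lmap (↥M) f)

/-- A left `S`-module `M` is *Gorenstein flat* if there is an exact sequence
`⋯ → F (-1) → F 0 → F 1 → ⋯` of flat left `S`-modules with `M ≅ Im (F 0 → F 1)` which stays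
exact after applying `I ⊗_S −` for every injective right `S`-module `I`
(a *complete flat resolution*). -/
def IsGorensteinFlat (M : ModuleCat.{u} S) : Prop :=
  ∃ (F : ℤ → ModuleCat.{u} S) (d : ∀ n : ℤ, ↥(F n) →ₗ[S] ↥(F (n + 1))),
    (∀ n, IsFlatMod S (F n)) ∧
    (∀ n, Function.Exact (d n) (d (n + 1))) ∧
    Nonempty (↥M ≃ₗ[S] ↥(LinearMap.range (d 0))) ∧
    (∀ (I : Type u) [AddCommGroup I] [Module Sᵐᵒᵖ I], Module.Injective Sᵐᵒᵖ I →
      ∀ n, Function.Exact (NTensor.rmap I (d n)) (NTensor.rmap I (d (n + 1))))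

/-- `gflatDimLE S n M` means `Gfd_S(M) ≤ n`: there is an exact sequence
`0 → G_n → ⋯ → G_0 → M → 0` of left `S`-modules with all `G_i` Gorenstein flat. -/
def gflatDimLE : ℕ → ModuleCat.{u} S → Prop
  | 0, M => IsGorensteinFlat S M
  | n + 1, M => ∃ (K G : ModuleCat.{u} S) (ι : ↥K →ₗ[S] ↥G) (π : ↥G →ₗ[S] ↥M),
      Function.Injective ι ∧ Function.Surjective π ∧ Function.Exact ι π ∧
      IsGorensteinFlat S G ∧ gflatDimLE n K

/-- `flatDimLE S n M` means `fd_S(M) ≤ n`: there is an exact sequence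
`0 → F_n → ⋯ → F_0 → M → 0` of left `S`-modules with all `F_i` flat. -/
def flatDimLE : ℕ → ModuleCat.{u} S → Prop
  | 0, M => IsFlatMod S M
  | n + 1, M => ∃ (K F : ModuleCat.{u} S) (ι : ↥K →ₗ[S] ↥F) (π : ↥F →ₗ[S] ↥M),
      Function.Injective ι ∧ Function.Surjective π ∧ Function.Exact ι π ∧
      IsFlatMod S F ∧ flatDimLE n K

/-- `injDimLE S n M` means `id_S(M) ≤ n`: there is an exact sequence
`0 → M → I^0 → ⋯ → I^n → 0` of left `S`-modules with all `I^i` injective. -/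
def injDimLE : ℕ → ModuleCat.{u} S → Prop
  | 0, M => Module.Injective S ↥M
  | n + 1, M => ∃ (I C : ModuleCat.{u} S) (ι : ↥M →ₗ[S] ↥I) (π : ↥I →ₗ[S] ↥C),
      Function.Injective ι ∧ Function.Surjective π ∧ Function.Exact ι π ∧
      Module.Injective S ↥I ∧ injDimLE n C

/-- The Gorenstein flat dimension `Gfd_S(M) ∈ ℕ∞` of a left `S`-module `M`. -/
noncomputable def gflatDim (M : ModuleCat.{u} S) : ℕ∞ :=
  sInf {d : ℕ∞ | ∃ n : ℕ, d = n ∧ gflatDimLE S n M}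

/-- The flat dimension `fd_S(M) ∈ ℕ∞` of a left `S`-module `M`. -/
noncomputable def flatDim (M : ModuleCat.{u} S) : ℕ∞ :=
  sInf {d : ℕ∞ | ∃ n : ℕ, d = n ∧ flatDimLE S n M}

/-- The injective dimension `id_S(M) ∈ ℕ∞` of a left `S`-module `M`. -/
noncomputable def injDim (M : ModuleCat.{u} S) : ℕ∞ :=
  sInf {d : ℕ∞ | ∃ n : ℕ, d = n ∧ injDimLE S n M}

/-- The left weak Gorenstein global dimension
`l.Gwdim(S) = sup { Gfd_S(M) | M a left S-module }`.  The right weak Gorenstein global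
dimension of `S` is `gorensteinWeakGlobalDim Sᵐᵒᵖ`. -/
noncomputable def gorensteinWeakGlobalDim : ℕ∞ :=
  ⨆ M : ModuleCat.{u} S, gflatDim S M

/-- The left weak global dimension `sup { fd_S(M) | M a left S-module }`.  (By a classical
theorem it agrees with `weakGlobalDim Sᵐᵒᵖ`, and the common value is `wdim S`.) -/
noncomputable def weakGlobalDim : ℕ∞ :=
  ⨆ M : ModuleCat.{u} S, flatDim S M

/-- The left finitistic flat dimension
`l.FFD(S) = sup { fd_S(M) | M a left S-module with fd_S(M) < ∞ }`. -/
noncomputable def finitisticFlatDim : ℕ∞ :=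
  sSup {d : ℕ∞ | d ≠ ⊤ ∧ ∃ M : ModuleCat.{u} S, flatDim S M = d}

/-- The left finitistic Gorenstein flat dimension
`l.FGFD(S) = sup { Gfd_S(M) | M a left S-module with Gfd_S(M) < ∞ }`. -/
noncomputable def finitisticGFlatDim : ℕ∞ :=
  sSup {d : ℕ∞ | d ≠ ⊤ ∧ ∃ M : ModuleCat.{u} S, gflatDim S M = d}

/-- A ring `S` is *left GF-closed* if the class of Gorenstein flat left `S`-modules is closed
under extensions.  `S` is right GF-closed iff `Sᵐᵒᵖ` is left GF-closed, and GF-closed if both. -/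
def IsGFClosed : Prop :=
  ∀ (A B C : ModuleCat.{u} S) (f : ↥A →ₗ[S] ↥B) (g : ↥B →ₗ[S] ↥C),
    Function.Injective f → Function.Surjective g → Function.Exact f g →
      IsGorensteinFlat S A → IsGorensteinFlat S C → IsGorensteinFlat S B

/-- A ring `S` is *left coherent* if every finitely generated left ideal of `S` is finitely
presented (as a left `S`-module).  `S` is right coherent iff `Sᵐᵒᵖ` is left coherent. -/
def IsLeftCoherent : Prop :=
  ∀ I : Submodule S S, I.FG → Module.FinitePresentation S ↥I

/-- A ring `S` is *left IF* if every injective left `S`-module is flat.  `S` is right IF iff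
`Sᵐᵒᵖ` is left IF, and IF if both. -/
def IsLeftIF : Prop :=
  ∀ E : ModuleCat.{u} S, Module.Injective S ↥E → IsFlatMod S E

/-- A ring `S` is *left `n`-IF* if `fd_S(E) ≤ n` for every injective left `S`-module `E`.
`S` is right `n`-IF iff `Sᵐᵒᵖ` is left `n`-IF, and `n`-IF if both. -/
def IsLeftNIF (n : ℕ) : Prop :=
  ∀ E : ModuleCat.{u} S, Module.Injective S ↥E → flatDim S E ≤ (n : ℕ∞)

/-- `Ext¹_S(T, K) = 0`, expressed by its standard characterization: every extension of `T`
by `K` (i.e. every short exact sequence `0 → K → X → T → 0`) splits. -/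
def Ext1Zero (T K : ModuleCat.{u} S) : Prop :=
  ∀ (X : ModuleCat.{u} S) (ι : ↥K →ₗ[S] ↥X) (π : ↥X →ₗ[S] ↥T),
    Function.Injective ι → Function.Surjective π → Function.Exact ι π →
      ∃ ρ : ↥X →ₗ[S] ↥K, ρ.comp ι = LinearMap.id

/-- A left `S`-module `K` is *cotorsion* if `Ext¹_S(F, K) = 0` for every flat left
`S`-module `F`. -/
def IsCotorsion (K : ModuleCat.{u} S) : Prop :=
  ∀ F : ModuleCat.{u} S, IsFlatMod S F → Ext1Zero S F K

/-- `Tor₁^S(A, T) = 0` for a right `S`-module `A` and a left `S`-module `T`, expressed by its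
standard characterization: for every short exact sequence `0 → K → F → T → 0` of left
`S`-modules with `F` flat, the induced map `A ⊗_S K → A ⊗_S F` is injective. -/
def Tor1Zero (A : Type u) [AddCommGroup A] [Module Sᵐᵒᵖ A] (T : ModuleCat.{u} S) : Prop :=
  ∀ (K F : ModuleCat.{u} S) (ι : ↥K →ₗ[S] ↥F) (π : ↥F →ₗ[S] ↥T),
    IsFlatMod S F → Function.Injective ι → Function.Surjective π → Function.Exact ι π →
      Function.Injective (NTensor.rmap A ι)

/-- A left `S`-module is *finitely presented* if it admits a presentation with finitely many
generators and relations. -/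
abbrev IsFinitelyPresented (M : ModuleCat.{u} S) : Prop :=
  Module.FinitePresentation S ↥M

end Dims

/-! ### Tensor products over a noncommutative ring -/

namespace NTensor

variable {S : Type u} [Ring S]
variable {A A' : Type u} [AddCommGroup A] [Module Sᵐᵒᵖ A] [AddCommGroup A'] [Module Sᵐᵒᵖ A']
variable {M M' : Type u} [AddCommGroup M] [Module S M] [AddCommGroup M'] [Module S M']

/-- The pure tensor `a ⊗ m`. -/
def tmul (a : A) (m : M) : NTensor S A M :=
  QuotientAddGroup.mk' (tensorRels S A M) (FreeAbelianGroup.of (a, m))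

theorem mk'_eq_of_sub_mem {x y : FreeAbelianGroup (A × M)} (h : x - y ∈ tensorRels S A M) :
    QuotientAddGroup.mk' (tensorRels S A M) x = QuotientAddGroup.mk' (tensorRels S A M) y := by
  rw [← sub_eq_zero, ← map_sub]
  exact (QuotientAddGroup.eq_zero_iff _).2 h

theorem add_tmul (a₁ a₂ : A) (m : M) :
    (tmul (a₁ + a₂) m : NTensor S A M) = tmul a₁ m + tmul a₂ m := by
  refine (mk'_eq_of_sub_mem ?_).trans (map_add (QuotientAddGroup.mk' (tensorRels S A M)) _ _)
  rw [← sub_sub]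
  exact AddSubgroup.subset_closure (Or.inl ⟨a₁, a₂, m, rfl⟩)

theorem tmul_add (a : A) (m₁ m₂ : M) :
    (tmul a (m₁ + m₂) : NTensor S A M) = tmul a m₁ + tmul a m₂ := by
  refine (mk'_eq_of_sub_mem ?_).trans (map_add (QuotientAddGroup.mk' (tensorRels S A M)) _ _)
  rw [← sub_sub]
  exact AddSubgroup.subset_closure (Or.inr (Or.inl ⟨a, m₁, m₂, rfl⟩))

theorem smul_tmul (s : S) (a : A) (m : M) :
    (tmul (op s • a) m : NTensor S A M) = tmul a (s • m) :=
  mk'_eq_of_sub_mem (AddSubgroup.subset_closure (Or.inr (Or.inr ⟨a, s, m, rfl⟩)))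

/-- The map `m ↦ a ⊗ m` as an additive homomorphism. -/
def tmulHom (a : A) : M →+ NTensor S A M :=
  AddMonoidHom.mk' (tmul a) (tmul_add a)

theorem tmul_zero (a : A) : (tmul a (0 : M) : NTensor S A M) = 0 :=
  map_zero (tmulHom a)

theorem tmul_sum {ι : Type*} (s : Finset ι) (a : A) (m : ι → M) :
    (tmul a (∑ i ∈ s, m i) : NTensor S A M) = ∑ i ∈ s, tmul a (m i) :=
  map_sum (tmulHom a) m s

/-- Two additive maps out of `A ⊗ M` agree as soon as they agree on pure tensors. -/
theorem addHom_ext {X : Type*} [AddCommGroup X] {f g : NTensor S A M →+ X}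
    (h : ∀ a m, f (tmul a m) = g (tmul a m)) : f = g := by
  refine QuotientAddGroup.addMonoidHom_ext _ (FreeAbelianGroup.lift_ext _ _ ?_)
  rintro ⟨a, m⟩
  exact h a m

/-- The additive map out of `A ⊗ M` induced by a balanced biadditive map. -/
def lift {X : Type*} [AddCommGroup X] (b : A → M → X)
    (add_left : ∀ a₁ a₂ m, b (a₁ + a₂) m = b a₁ m + b a₂ m)
    (add_right : ∀ a m₁ m₂, b a (m₁ + m₂) = b a m₁ + b a m₂)
    (balanced : ∀ (s : S) a m, b (op s • a) m = b a (s • m)) : NTensor S A M →+ X :=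
  QuotientAddGroup.lift (tensorRels S A M) (FreeAbelianGroup.lift fun x => b x.1 x.2) (by
    refine (AddSubgroup.closure_le _).2 ?_
    rintro x (⟨a₁, a₂, m, rfl⟩ | ⟨a, m₁, m₂, rfl⟩ | ⟨a, r, m, rfl⟩) <;>
      simp [add_left, add_right, balanced])

@[simp]
theorem lift_tmul {X : Type*} [AddCommGroup X] (b : A → M → X) (h₁ h₂)
    (h₃ : ∀ (s : S) a m, b (op s • a) m = b a (s • m)) (a : A) (m : M) :
    lift b h₁ h₂ h₃ (tmul a m) = b a m :=
  FreeAbelianGroup.lift_apply_of (fun x : A × M => b x.1 x.2) (a, m)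

@[simp]
theorem rmap_tmul (g : M →ₗ[S] M') (a : A) (m : M) : rmap A g (tmul a m) = tmul a (g m) :=
  congrArg (QuotientAddGroup.mk' (tensorRels S A M')) (FreeAbelianGroup.map_of_apply (a, m))

@[simp]
theorem lmap_tmul (f : A →ₗ[Sᵐᵒᵖ] A') (a : A) (m : M) : lmap M f (tmul a m) = tmul (f a) m :=
  congrArg (QuotientAddGroup.mk' (tensorRels S A' M)) (FreeAbelianGroup.map_of_apply (a, m))

instance [Subsingleton M] : Subsingleton (NTensor S A M) := by
  have h : AddMonoidHom.id (NTensor S A M) = 0 :=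
    addHom_ext fun a m => by simp [Subsingleton.elim m 0, tmul_zero]
  exact ⟨fun x y => (DFunLike.congr_fun h x).trans (DFunLike.congr_fun h y).symm⟩

end NTensor

/-! ### Exactness and retracts -/

section Retract

variable {A B C : Type*} [AddCommGroup A] [AddCommGroup B] [AddCommGroup C]
  {f : A →+ B} {g : B →+ C}

theorem Function.Exact.of_retract {A' B' C' : Type*} [AddCommGroup A'] [AddCommGroup B']
    [AddCommGroup C'] {f' : A' →+ B'} {g' : B' →+ C'} (h : Function.Exact f g)
    (pA : A →+ A') (iA : A' →+ A) (pB : B →+ B') (iB : B' →+ B) (pC : C →+ C') (iC : C' →+ C)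
    (hB : ∀ b, pB (iB b) = b)
    (pf : ∀ a, pB (f a) = f' (pA a)) (fi : ∀ a, f (iA a) = iB (f' a))
    (pg : ∀ b, pC (g b) = g' (pB b)) (gi : ∀ b, g (iB b) = iC (g' b)) :
    Function.Exact f' g' := by
  intro b
  constructor
  · intro hb
    obtain ⟨a, ha⟩ := (h (iB b)).1 (by rw [gi, hb, map_zero])
    exact ⟨pA a, by rw [← pf, ha, hB]⟩
  · rintro ⟨a, rfl⟩
    rw [← hB (f' a), ← fi, ← pg, h.apply_apply_eq_zero, map_zero]

variable {ι : Type*} [Fintype ι] {A' B' C' : ι → Type*} [∀ i, AddCommGroup (A' i)]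
  [∀ i, AddCommGroup (B' i)] [∀ i, AddCommGroup (C' i)]
  {f' : ∀ i, A' i →+ B' i} {g' : ∀ i, B' i →+ C' i}

theorem Function.Exact.of_components (h : ∀ i, Function.Exact (f' i) (g' i))
    (pA : ∀ i, A →+ A' i) (iA : ∀ i, A' i →+ A) (pB : ∀ i, B →+ B' i) (iB : ∀ i, B' i →+ B)
    (pC : ∀ i, C →+ C' i) (iC : ∀ i, C' i →+ C)
    (hB : ∀ b, ∑ i, iB i (pB i b) = b) (hC : ∀ c, ∑ i, iC i (pC i c) = c)
    (pf : ∀ i a, pB i (f a) = f' i (pA i a)) (fi : ∀ i a, f (iA i a) = iB i (f' i a))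
    (pg : ∀ i b, pC i (g b) = g' i (pB i b)) :
    Function.Exact f g := by
  intro b
  constructor
  · intro hb
    have key : ∀ i, ∃ a, f' i a = pB i b := fun i =>
      (h i _).1 (by rw [← pg, hb, map_zero])
    choose a ha using key
    exact ⟨∑ i, iA i (a i), by simp [map_sum, fi, ha, hB]⟩
  · rintro ⟨a, rfl⟩
    rw [← hC (g (f a))]
    simp [pg, pf, (h _).apply_apply_eq_zero]

end Retract

/-! ### Ring direct factors -/

/-- `R` is a direct factor of the ring `S`, embedded as the two-sided ideal generated by the
central idempotent `sec 1`. -/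
structure RingFactor (S R : Type u) [Ring S] [Ring R] where
  /-- The projection onto the factor. -/
  proj : S →+* R
  /-- The (non-unital) inclusion of the factor. -/
  sec : R →ₙ+* S
  proj_sec : ∀ r, proj (sec r) = r
  sec_proj : ∀ s, sec (proj s) = sec 1 * s
  sec_proj' : ∀ s, sec (proj s) = s * sec 1

namespace RingFactor

variable {S R : Type u} [Ring S] [Ring R]

/-- The opposite of a direct factor is a direct factor of the opposite ring. -/
def op (F : RingFactor S R) : RingFactor Sᵐᵒᵖ Rᵐᵒᵖ where
  proj := F.proj.op
  sec := NonUnitalRingHom.op F.sec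
  proj_sec r := unop_injective (F.proj_sec r.unop)
  sec_proj s := unop_injective (F.sec_proj' s.unop)
  sec_proj' s := unop_injective (F.sec_proj s.unop)

/-- `N` is the component at the factor `R` of the `S`-module `M`. -/
structure Component (F : RingFactor S R) (M N : Type*) [AddCommGroup M] [Module S M]
    [AddCommGroup N] [Module R N] where
  /-- The projection of the module onto its component. -/
  pr : M →+ N
  /-- The inclusion of the component. -/
  inc : N →+ M
  pr_inc : ∀ n, pr (inc n) = n
  inc_pr : ∀ m, inc (pr m) = F.sec 1 • m
  pr_smul : ∀ (s : S) m, pr (s • m) = F.proj s • pr m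

namespace Component

variable {F : RingFactor S R}
variable {M M' N N' : Type*} [AddCommGroup M] [Module S M] [AddCommGroup M'] [Module S M']
  [AddCommGroup N] [Module R N] [AddCommGroup N'] [Module R N']
  (c : F.Component M N) (c' : F.Component M' N')

theorem sec_one_smul_inc (n : N) : F.sec 1 • c.inc n = c.inc n := by
  rw [← c.inc_pr, c.pr_inc]

theorem inc_proj_smul (s : S) (n : N) : c.inc (F.proj s • n) = s • c.inc n := by
  conv_lhs => rw [← c.pr_inc n]
  rw [← c.pr_smul, c.inc_pr, smul_smul, ← F.sec_proj, F.sec_proj', mul_smul, sec_one_smul_inc]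

theorem inc_smul (r : R) (n : N) : c.inc (r • n) = F.sec r • c.inc n := by
  rw [← c.inc_proj_smul, F.proj_sec]

theorem inc_injective : Function.Injective c.inc :=
  Function.LeftInverse.injective c.pr_inc

/-- The map induced on components by an `S`-linear map. -/
def map (f : M →ₗ[S] M') : N →ₗ[R] N' where
  toFun n := c'.pr (f (c.inc n))
  map_add' x y := by simp
  map_smul' r n := by simp [c.inc_smul, c'.pr_smul, F.proj_sec]

theorem pr_apply (f : M →ₗ[S] M') (m : M) : c'.pr (f m) = c.map c' f (c.pr m) := by
  simp [map, c.inc_pr, c'.pr_smul, F.proj_sec]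

theorem apply_inc (f : M →ₗ[S] M') (n : N) : f (c.inc n) = c'.inc (c.map c' f n) := by
  simp only [map, LinearMap.coe_mk, AddHom.coe_mk]
  rw [c'.inc_pr, ← map_smul, c.sec_one_smul_inc]

theorem map_injective {f : M →ₗ[S] M'} (hf : Function.Injective f) :
    Function.Injective (c.map c' f) := by
  intro x y h
  apply c.inc_injective
  apply hf
  rw [c.apply_inc c', c.apply_inc c', h]

theorem map_surjective {f : M →ₗ[S] M'} (hf : Function.Surjective f) :
    Function.Surjective (c.map c' f) := by
  intro y
  obtain ⟨x, hx⟩ := hf (c'.inc y)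
  exact ⟨c.pr x, by rw [← c.pr_apply c', hx, c'.pr_inc]⟩

theorem map_exact {M'' N'' : Type*} [AddCommGroup M''] [Module S M''] [AddCommGroup N'']
    [Module R N''] (c'' : F.Component M'' N'') {f : M →ₗ[S] M'} {g : M' →ₗ[S] M''}
    (h : Function.Exact f g) : Function.Exact (c.map c' f) (c'.map c'' g) :=
  Function.Exact.of_retract (f := f.toAddMonoidHom) (g := g.toAddMonoidHom)
    (f' := (c.map c' f).toAddMonoidHom) (g' := (c'.map c'' g).toAddMonoidHom) h
    c.pr c.inc c'.pr c'.inc c''.pr c''.inc c'.pr_inc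
    (c.pr_apply c' f) (c.apply_inc c' f) (c'.pr_apply c'' g) (c'.apply_inc c'' g)

end Component

/-! ### Components and restriction of scalars -/

section Constructions

variable (F : RingFactor S R)

/-- The component `eM` of an `S`-module `M`, where `e = F.sec 1`. -/
def Part (M : Type*) [AddCommGroup M] [Module S M] : Type _ :=
  (DistribSMul.toAddMonoidHom M (F.sec 1) - AddMonoidHom.id M).ker

variable (M : Type*) [AddCommGroup M] [Module S M]

instance : AddCommGroup (F.Part M) :=
  inferInstanceAs
    (AddCommGroup (DistribSMul.toAddMonoidHom M (F.sec 1) - AddMonoidHom.id M).ker)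

/-- The inclusion `eM → M`. -/
def Part.val : F.Part M →+ M := AddSubgroup.subtype _

theorem Part.val_injective : Function.Injective (Part.val F M) := Subtype.val_injective

variable {M}

theorem Part.sec_one_smul_val (x : F.Part M) : F.sec 1 • Part.val F M x = Part.val F M x :=
  sub_eq_zero.1 x.2

/-- An element of `M` fixed by `e`, as an element of `eM`. -/
def Part.mk (m : M) (h : F.sec 1 • m = m) : F.Part M := ⟨m, sub_eq_zero.2 h⟩

@[simp]
theorem Part.val_mk (m : M) (h : F.sec 1 • m = m) : Part.val F M (Part.mk F m h) = m := rfl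

theorem sec_one_smul_sec_smul (r : R) (m : M) : F.sec 1 • F.sec r • m = F.sec r • m := by
  rw [smul_smul, ← map_mul, one_mul]

instance : SMul R (F.Part M) :=
  ⟨fun r x => Part.mk F (F.sec r • Part.val F M x) (F.sec_one_smul_sec_smul r _)⟩

theorem Part.val_smul (r : R) (x : F.Part M) :
    Part.val F M (r • x) = F.sec r • Part.val F M x := rfl

instance : Module R (F.Part M) where
  one_smul x := Part.val_injective F M (Part.sec_one_smul_val F x)
  mul_smul r s x := Part.val_injective F M (by simp [Part.val_smul, mul_smul])
  smul_zero r := Part.val_injective F M (by simp [Part.val_smul])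
  smul_add r x y := Part.val_injective F M (by simp [Part.val_smul])
  add_smul r s x := Part.val_injective F M (by simp [Part.val_smul, add_smul])
  zero_smul x := Part.val_injective F M (by simp [Part.val_smul])

variable (M) in
/-- `eM` is a component of `M`. -/
def partComponent : F.Component M (F.Part M) where
  pr := AddMonoidHom.mk' (fun m => Part.mk F (F.sec 1 • m) (F.sec_one_smul_sec_smul 1 m))
    fun x y => Part.val_injective F M (by simp)
  inc := Part.val F M
  pr_inc n := Part.val_injective F M (Part.sec_one_smul_val F n)
  inc_pr _ := rfl
  pr_smul s m := Part.val_injective F M (by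
    simp only [AddMonoidHom.mk'_apply, Part.val_smul, Part.val_mk]
    rw [smul_smul, smul_smul, F.sec_proj, mul_assoc, ← F.sec_proj', F.sec_proj, ← mul_assoc,
      ← map_mul, one_mul])

/-- An `R`-module regarded as an `S`-module along the projection `S → R`. -/
@[nolint unusedArguments]
def Res (_ : RingFactor S R) (N : Type*) : Type _ := N

variable (N : Type*) [AddCommGroup N] [Module R N]

instance : AddCommGroup (F.Res N) := inferInstanceAs (AddCommGroup N)

instance : Module S (F.Res N) := Module.compHom N F.proj

/-- An `R`-module is the component of its restriction of scalars. -/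
def resComponent : F.Component (F.Res N) N where
  pr := AddMonoidHom.id N
  inc := AddMonoidHom.id N
  pr_inc _ := rfl
  inc_pr m := by
    change m = F.proj (F.sec 1) • (show N from m)
    rw [F.proj_sec, one_smul]
  pr_smul _ _ := rfl

variable {N} {N' : Type*} [AddCommGroup N'] [Module R N']

/-- Restriction of scalars of a linear map. -/
def resMap (f : N →ₗ[R] N') : F.Res N →ₗ[S] F.Res N' where
  toFun := f
  map_add' := map_add f
  map_smul' s n := map_smul f (F.proj s) (show N from n)

end Constructions

/-! ### Injectivity -/

section Injective

variable (F : RingFactor S R)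

theorem injective_res {J : Type u} [AddCommGroup J] [Module R J] (hJ : Module.Injective R J) :
    Module.Injective S (F.Res J) := by
  refine ⟨fun X Y _ _ _ _ f hf g => ?_⟩
  let cX := F.partComponent X
  let cY := F.partComponent Y
  let cJ := F.resComponent J
  obtain ⟨h, hh⟩ := hJ.out (cX.map cY f) (cX.map_injective cY hf) (cX.map cJ g)
  refine ⟨{ toFun := fun y => cJ.inc (h (cY.pr y))
            map_add' := by simp
            map_smul' := by simp [cY.pr_smul, cJ.inc_proj_smul] }, fun x => ?_⟩
  change cJ.inc (h (cY.pr (f x))) = g x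
  rw [cX.pr_apply cY, hh, ← cX.pr_apply cJ]
  rfl

theorem Component.injective {F : RingFactor S R} {I J : Type u} [AddCommGroup I] [Module S I]
    [AddCommGroup J] [Module R J] (c : F.Component I J) (hI : Module.Injective S I) :
    Module.Injective R J := by
  refine ⟨fun X Y _ _ _ _ f hf g => ?_⟩
  let cX := F.resComponent X
  let cY := F.resComponent Y
  obtain ⟨h, hh⟩ := hI.out (F.resMap f) hf
    { toFun := fun x => c.inc (g (cX.pr x))
      map_add' := by simp
      map_smul' := by simp [cX.pr_smul, c.inc_proj_smul] }
  refine ⟨cY.map c h, fun x => ?_⟩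
  exact (congrArg c.pr (hh x)).trans (c.pr_inc _)

end Injective

/-! ### Tensor products of components -/

namespace Component

variable {F : RingFactor S R}
variable {A B M N : Type u} [AddCommGroup A] [Module Sᵐᵒᵖ A] [AddCommGroup B] [Module Rᵐᵒᵖ B]
  [AddCommGroup M] [Module S M] [AddCommGroup N] [Module R N]
  (b : F.op.Component A B) (c : F.Component M N)

/-- The projection `A ⊗_S M → eA ⊗_R eM`. -/
def tensorPr : NTensor S A M →+ NTensor R B N :=
  NTensor.lift (fun x m => NTensor.tmul (b.pr x) (c.pr m))
    (by simp [NTensor.add_tmul]) (by simp [NTensor.tmul_add])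
    (fun s x m => by
      rw [b.pr_smul, c.pr_smul]
      exact NTensor.smul_tmul _ _ _)

/-- The inclusion `eA ⊗_R eM → A ⊗_S M`. -/
def tensorInc : NTensor R B N →+ NTensor S A M :=
  NTensor.lift (fun x m => NTensor.tmul (b.inc x) (c.inc m))
    (by simp [NTensor.add_tmul]) (by simp [NTensor.tmul_add])
    (fun s x m => by
      rw [b.inc_smul, c.inc_smul]
      exact NTensor.smul_tmul _ _ _)

@[simp]
theorem tensorPr_tmul (x : A) (m : M) :
    b.tensorPr c (NTensor.tmul x m) = NTensor.tmul (b.pr x) (c.pr m) :=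
  NTensor.lift_tmul ..

@[simp]
theorem tensorInc_tmul (x : B) (n : N) :
    b.tensorInc c (NTensor.tmul x n) = NTensor.tmul (b.inc x) (c.inc n) :=
  NTensor.lift_tmul ..

theorem tensorPr_tensorInc (t : NTensor R B N) : b.tensorPr c (b.tensorInc c t) = t :=
  DFunLike.congr_fun (NTensor.addHom_ext (f := (b.tensorPr c).comp (b.tensorInc c))
    (g := AddMonoidHom.id _) fun x n => by simp [b.pr_inc, c.pr_inc]) t

theorem tensorInc_tensorPr_tmul (x : A) (m : M) :
    b.tensorInc c (b.tensorPr c (NTensor.tmul x m)) = NTensor.tmul x (F.sec 1 • m) := by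
  simp only [tensorPr_tmul, tensorInc_tmul, b.inc_pr, c.inc_pr]
  refine (NTensor.smul_tmul (F.sec 1) _ _).trans ?_
  rw [F.sec_one_smul_sec_smul]

variable {A' B' M' N' : Type u} [AddCommGroup A'] [Module Sᵐᵒᵖ A'] [AddCommGroup B']
  [Module Rᵐᵒᵖ B'] [AddCommGroup M'] [Module S M'] [AddCommGroup N'] [Module R N']
  (b' : F.op.Component A' B') (c' : F.Component M' N')

theorem tensorPr_rmap {f : M →ₗ[S] M'} {f' : N →ₗ[R] N'} (h : ∀ m, c'.pr (f m) = f' (c.pr m))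
    (t : NTensor S A M) :
    b.tensorPr c' (NTensor.rmap A f t) = NTensor.rmap B f' (b.tensorPr c t) :=
  DFunLike.congr_fun (NTensor.addHom_ext (f := (b.tensorPr c').comp (NTensor.rmap A f))
    (g := (NTensor.rmap B f').comp (b.tensorPr c)) fun x m => by simp [h]) t

theorem rmap_tensorInc {f : M →ₗ[S] M'} {f' : N →ₗ[R] N'}
    (h : ∀ n, f (c.inc n) = c'.inc (f' n)) (t : NTensor R B N) :
    NTensor.rmap A f (b.tensorInc c t) = b.tensorInc c' (NTensor.rmap B f' t) :=
  DFunLike.congr_fun (NTensor.addHom_ext (f := (NTensor.rmap A f).comp (b.tensorInc c))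
    (g := (b.tensorInc c').comp (NTensor.rmap B f')) fun x m => by simp [h]) t

theorem tensorPr_lmap {f : A →ₗ[Sᵐᵒᵖ] A'} {f' : B →ₗ[Rᵐᵒᵖ] B'}
    (h : ∀ x, b'.pr (f x) = f' (b.pr x)) (t : NTensor S A M) :
    b'.tensorPr c (NTensor.lmap M f t) = NTensor.lmap N f' (b.tensorPr c t) :=
  DFunLike.congr_fun (NTensor.addHom_ext (f := (b'.tensorPr c).comp (NTensor.lmap M f))
    (g := (NTensor.lmap N f').comp (b.tensorPr c)) fun x m => by simp [h]) t

theorem lmap_tensorInc {f : A →ₗ[Sᵐᵒᵖ] A'} {f' : B →ₗ[Rᵐᵒᵖ] B'}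
    (h : ∀ x, f (b.inc x) = b'.inc (f' x)) (t : NTensor R B N) :
    NTensor.lmap M f (b.tensorInc c t) = b'.tensorInc c (NTensor.lmap N f' t) :=
  DFunLike.congr_fun (NTensor.addHom_ext (f := (NTensor.lmap M f).comp (b.tensorInc c))
    (g := (b'.tensorInc c).comp (NTensor.lmap N f')) fun x m => by simp [h]) t

end Component

end RingFactor

/-! ### Gorenstein flat dimension -/

section GorensteinFlat

variable {S : Type u} [Ring S]

/-- In an exact sequence, being isomorphic to the image of `d 0` amounts to being a kernel
of `d 1`. -/
theorem nonempty_equiv_range_iff {M X Y Z : Type*} [AddCommGroup M] [AddCommGroup X]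
    [AddCommGroup Y] [AddCommGroup Z] [Module S M] [Module S X] [Module S Y] [Module S Z]
    {d : X →ₗ[S] Y} {d' : Y →ₗ[S] Z} (h : Function.Exact d d') :
    Nonempty (M ≃ₗ[S] LinearMap.range d) ↔
      ∃ j : M →ₗ[S] Y, Function.Injective j ∧ Function.Exact j d' := by
  constructor
  · rintro ⟨e⟩
    refine ⟨(LinearMap.range d).subtype ∘ₗ e.toLinearMap,
      Subtype.val_injective.comp e.injective, ?_⟩
    rw [LinearMap.exact_iff, LinearMap.range_comp, LinearEquiv.range, Submodule.map_top,
      Submodule.range_subtype, LinearMap.exact_iff.1 h]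
  · rintro ⟨j, hj, hex⟩
    exact ⟨(LinearEquiv.ofInjective j hj).trans
      (LinearEquiv.ofEq _ _ ((LinearMap.exact_iff.1 hex).symm.trans (LinearMap.exact_iff.1 h)))⟩

theorem isGorensteinFlat_of_subsingleton (M : ModuleCat.{u} S) [Subsingleton M] :
    IsGorensteinFlat S M := by
  refine ⟨fun _ => M, fun _ => 0, fun _ A B _ _ _ _ f _ => Function.injective_of_subsingleton _,
    fun _ x => ?_, ⟨0, 0, fun _ => Subsingleton.elim _ _, ?_⟩, fun I _ _ _ _ x => ?_⟩
  · simp [Subsingleton.elim x 0]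
  · rintro ⟨_, y, rfl⟩
    rfl
  · exact iff_of_true (Subsingleton.elim _ _) ⟨0, Subsingleton.elim _ _⟩

theorem gflatDimLE_succ {n : ℕ} {M : ModuleCat.{u} S} (h : gflatDimLE S n M) :
    gflatDimLE S (n + 1) M := by
  induction n generalizing M with
  | zero =>
    refine ⟨ModuleCat.of S PUnit, M, 0, LinearMap.id, Function.injective_of_subsingleton _,
      Function.surjective_id, fun x => ?_, h,
      isGorensteinFlat_of_subsingleton (ModuleCat.of S PUnit)⟩
    simp [eq_comm]
  | succ n ih =>
    obtain ⟨K, G, i, p, hi, hp, hex, hG, hK⟩ := h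
    exact ⟨K, G, i, p, hi, hp, hex, hG, ih hK⟩

theorem gflatDimLE_mono {m n : ℕ} (hmn : m ≤ n) {M : ModuleCat.{u} S} (h : gflatDimLE S m M) :
    gflatDimLE S n M :=
  Nat.le_induction h (fun _ _ => gflatDimLE_succ) n hmn

theorem gflatDim_le_natCast_iff {n : ℕ} {M : ModuleCat.{u} S} :
    gflatDim S M ≤ n ↔ gflatDimLE S n M := by
  refine ⟨fun h => ?_, fun h => sInf_le ⟨n, rfl, h⟩⟩
  have hne : {d : ℕ∞ | ∃ n : ℕ, d = n ∧ gflatDimLE S n M}.Nonempty := by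
    by_contra hne
    rw [Set.not_nonempty_iff_eq_empty] at hne
    rw [gflatDim, hne, sInf_empty] at h
    exact ENat.natCast_ne_top n (top_le_iff.1 h)
  obtain ⟨k, hk, hM⟩ := csInf_mem hne
  refine gflatDimLE_mono ?_ hM
  rw [gflatDim, hk] at h
  exact_mod_cast h

theorem gorensteinWeakGlobalDim_le_natCast_iff {n : ℕ} :
    gorensteinWeakGlobalDim S ≤ n ↔ ∀ M : ModuleCat.{u} S, gflatDimLE S n M := by
  simp only [gorensteinWeakGlobalDim, iSup_le_iff, gflatDim_le_natCast_iff]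

end GorensteinFlat

/-! ### Passing to a component -/

namespace RingFactor.Component

variable {S R : Type u} [Ring S] [Ring R] {F : RingFactor S R}

theorem isFlatMod {M : ModuleCat.{u} S} {N : ModuleCat.{u} R} (c : F.Component M N)
    (h : IsFlatMod S M) : IsFlatMod R N := by
  intro A B _ _ _ _ f hf
  let cA := F.op.resComponent A
  let cB := F.op.resComponent B
  have key := h _ _ (F.op.resMap f) hf
  intro x y hxy
  have := key (a₁ := cA.tensorInc c x) (a₂ := cA.tensorInc c y) (by
    rw [cA.lmap_tensorInc c cB (f := F.op.resMap f) (f' := f) (fun _ => rfl),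
      cA.lmap_tensorInc c cB (f := F.op.resMap f) (f' := f) (fun _ => rfl), hxy])
  rw [← cA.tensorPr_tensorInc c x, this, cA.tensorPr_tensorInc c y]

theorem isGorensteinFlat {M : ModuleCat.{u} S} {N : ModuleCat.{u} R} (c : F.Component M N)
    (h : IsGorensteinFlat S M) : IsGorensteinFlat R N := by
  obtain ⟨X, d, hflat, hex, hM, hten⟩ := h
  obtain ⟨j, hj, hjd⟩ := (nonempty_equiv_range_iff (hex 0)).1 hM
  let cX := fun n => F.partComponent (X n)
  have hex' := fun n => (cX n).map_exact (cX (n + 1)) (cX (n + 1 + 1)) (hex n)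
  refine ⟨fun n => ModuleCat.of R (F.Part (X n)), fun n => (cX n).map (cX (n + 1)) (d n),
    fun n => isFlatMod (N := ModuleCat.of R (F.Part (X n))) (cX n) (hflat n), hex',
    (nonempty_equiv_range_iff (hex' 0)).2
      ⟨c.map (cX (0 + 1)) j, c.map_injective _ hj, c.map_exact _ _ hjd⟩, ?_⟩
  intro I _ _ hI n
  let b := F.op.resComponent I
  exact Function.Exact.of_retract (hten (F.op.Res I) (F.op.injective_res hI) n)
    (b.tensorPr (cX n)) (b.tensorInc (cX n)) (b.tensorPr (cX (n + 1)))
    (b.tensorInc (cX (n + 1))) (b.tensorPr (cX (n + 1 + 1))) (b.tensorInc (cX (n + 1 + 1)))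
    (b.tensorPr_tensorInc _)
    (b.tensorPr_rmap _ _ ((cX n).pr_apply _ _)) (b.rmap_tensorInc _ _ ((cX n).apply_inc _ _))
    (b.tensorPr_rmap _ _ ((cX (n + 1)).pr_apply _ _))
    (b.rmap_tensorInc _ _ ((cX (n + 1)).apply_inc _ _))

theorem gflatDimLE {n : ℕ} {M : ModuleCat.{u} S} {N : ModuleCat.{u} R} (c : F.Component M N)
    (h : gflatDimLE S n M) : gflatDimLE R n N := by
  induction n generalizing M N with
  | zero => exact c.isGorensteinFlat h
  | succ n ih =>
    obtain ⟨K, G, i, p, hi, hp, hex, hG, hK⟩ := h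
    let cK := F.partComponent K
    let cG := F.partComponent G
    exact ⟨ModuleCat.of R (F.Part K), ModuleCat.of R (F.Part G), cK.map cG i, cG.map c p,
      cK.map_injective cG hi, cG.map_surjective c hp, cK.map_exact cG c hex,
      isGorensteinFlat (N := ModuleCat.of R (F.Part G)) cG hG,
      ih (N := ModuleCat.of R (F.Part K)) cK hK⟩

end RingFactor.Component

theorem RingFactor.gorensteinWeakGlobalDim_le {S R : Type u} [Ring S] [Ring R]
    (F : RingFactor S R) : gorensteinWeakGlobalDim R ≤ gorensteinWeakGlobalDim S := by
  induction h : gorensteinWeakGlobalDim S using ENat.recTopCoe with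
  | top => exact le_top
  | coe n =>
    refine gorensteinWeakGlobalDim_le_natCast_iff.2 fun N =>
      Component.gflatDimLE (M := ModuleCat.of S (F.Res N)) (F.resComponent N) ?_
    exact gorensteinWeakGlobalDim_le_natCast_iff.1 h.le _

/-! ### Gluing along a complete family of factors -/

/-- A decomposition of the ring `S` as a finite product of the rings `R i`. -/
structure RingDecomposition {ι : Type} [Fintype ι] (S : Type u) (R : ι → Type u) [Ring S]
    [∀ i, Ring (R i)] where
  /-- The factors. -/
  factor : ∀ i, RingFactor S (R i)
  sum_sec_one : ∑ i, (factor i).sec 1 = 1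
  proj_sec_one : ∀ i j, i ≠ j → (factor j).proj ((factor i).sec 1) = 0

namespace RingDecomposition

variable {ι : Type} [Fintype ι] {S : Type u} {R : ι → Type u} [Ring S] [∀ i, Ring (R i)]
  (D : RingDecomposition S R)

/-- The opposite decomposition. -/
def op : RingDecomposition Sᵐᵒᵖ (fun i => (R i)ᵐᵒᵖ) where
  factor i := (D.factor i).op
  sum_sec_one := unop_injective ((Finset.unop_sum _ _).trans D.sum_sec_one)
  proj_sec_one i j h := unop_injective (D.proj_sec_one i j h)

/-- A compatible choice of all components of an `S`-module. -/
abbrev Components (M : Type*) (N : ι → Type*) [AddCommGroup M] [Module S M]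
    [∀ i, AddCommGroup (N i)] [∀ i, Module (R i) (N i)] :=
  ∀ i, (D.factor i).Component M (N i)

section Components

variable {D}
variable {M M' : Type*} {N N' : ι → Type*} [AddCommGroup M] [Module S M] [AddCommGroup M']
  [Module S M'] [∀ i, AddCommGroup (N i)] [∀ i, Module (R i) (N i)] [∀ i, AddCommGroup (N' i)]
  [∀ i, Module (R i) (N' i)] (c : D.Components M N) (c' : D.Components M' N')

namespace Components

theorem sum_inc_pr (m : M) : ∑ i, (c i).inc ((c i).pr m) = m := by
  simp [(c _).inc_pr, ← Finset.sum_smul, D.sum_sec_one]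

theorem pr_inc_of_ne {i j : ι} (h : i ≠ j) (n : N i) : (c j).pr ((c i).inc n) = 0 := by
  rw [← (c i).sec_one_smul_inc, (c j).pr_smul, D.proj_sec_one i j h, zero_smul]

theorem pr_sum_inc (n : ∀ i, N i) (j : ι) : (c j).pr (∑ i, (c i).inc (n i)) = n j := by
  rw [map_sum, Finset.sum_eq_single j (fun i _ h => pr_inc_of_ne c h _) (by simp), (c j).pr_inc]

/-- The `S`-linear map with prescribed maps on components. -/
def glue (f : ∀ i, N i →ₗ[R i] N' i) : M →ₗ[S] M' where
  toFun m := ∑ i, (c' i).inc (f i ((c i).pr m))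
  map_add' x y := by simp [Finset.sum_add_distrib]
  map_smul' s m := by simp [(c _).pr_smul, (c' _).inc_proj_smul, Finset.smul_sum]

theorem pr_glue (f : ∀ i, N i →ₗ[R i] N' i) (i : ι) (m : M) :
    (c' i).pr (glue c c' f m) = f i ((c i).pr m) :=
  pr_sum_inc c' _ i

theorem glue_inc (f : ∀ i, N i →ₗ[R i] N' i) (i : ι) (n : N i) :
    glue c c' f ((c i).inc n) = (c' i).inc (f i n) := by
  refine (Finset.sum_eq_single i (fun j _ h => ?_) (by simp)).trans ?_
  · rw [pr_inc_of_ne c h.symm, map_zero, map_zero]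
  · rw [(c i).pr_inc]

theorem glue_injective {f : ∀ i, N i →ₗ[R i] N' i} (hf : ∀ i, Function.Injective (f i)) :
    Function.Injective (glue c c' f) := by
  intro x y h
  rw [← sum_inc_pr c x, ← sum_inc_pr c y]
  refine Finset.sum_congr rfl fun i _ => congrArg _ (hf i ?_)
  rw [← pr_glue c c', ← pr_glue c c', h]

theorem glue_surjective {f : ∀ i, N i →ₗ[R i] N' i} (hf : ∀ i, Function.Surjective (f i)) :
    Function.Surjective (glue c c' f) := by
  intro y
  choose x hx using fun i => hf i ((c' i).pr y)
  exact ⟨∑ i, (c i).inc (x i), by simp [map_sum, glue_inc, hx, sum_inc_pr]⟩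

theorem glue_exact {M'' : Type*} {N'' : ι → Type*} [AddCommGroup M''] [Module S M'']
    [∀ i, AddCommGroup (N'' i)] [∀ i, Module (R i) (N'' i)] (c'' : D.Components M'' N'')
    {f : ∀ i, N i →ₗ[R i] N' i} {g : ∀ i, N' i →ₗ[R i] N'' i}
    (h : ∀ i, Function.Exact (f i) (g i)) : Function.Exact (glue c c' f) (glue c' c'' g) :=
  Function.Exact.of_components (f := (glue c c' f).toAddMonoidHom)
    (g := (glue c' c'' g).toAddMonoidHom) (f' := fun i => (f i).toAddMonoidHom)
    (g' := fun i => (g i).toAddMonoidHom) h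
    (fun i => (c i).pr) (fun i => (c i).inc) (fun i => (c' i).pr) (fun i => (c' i).inc)
    (fun i => (c'' i).pr) (fun i => (c'' i).inc) (sum_inc_pr c') (sum_inc_pr c'')
    (pr_glue c c' f) (glue_inc c c' f) (pr_glue c' c'' g)

end Components

end Components

theorem sum_tensorInc_tensorPr {A M : Type u} {B N : ι → Type u} [AddCommGroup A]
    [Module Sᵐᵒᵖ A] [AddCommGroup M] [Module S M] [∀ i, AddCommGroup (B i)]
    [∀ i, Module (R i)ᵐᵒᵖ (B i)] [∀ i, AddCommGroup (N i)] [∀ i, Module (R i) (N i)]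
    (b : ∀ i, (D.factor i).op.Component A (B i)) (c : D.Components M N) (t : NTensor S A M) :
    ∑ i, (b i).tensorInc (c i) ((b i).tensorPr (c i) t) = t := by
  have h : ∑ i, ((b i).tensorInc (c i)).comp ((b i).tensorPr (c i)) = AddMonoidHom.id _ :=
    NTensor.addHom_ext fun x m => by
      simp only [AddMonoidHom.finsetSum_apply, AddMonoidHom.comp_apply,
        RingFactor.Component.tensorInc_tensorPr_tmul, ← NTensor.tmul_sum, ← Finset.sum_smul,
        D.sum_sec_one, one_smul, AddMonoidHom.id_apply]
  simpa using DFunLike.congr_fun h t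

/-- The `S`-module with prescribed components. -/
@[nolint unusedArguments]
def Glued (_ : RingDecomposition S R) (N : ι → Type*) : Type _ := ∀ i, N i

section Glued

variable (N : ι → Type*) [∀ i, AddCommGroup (N i)] [∀ i, Module (R i) (N i)]

instance : AddCommGroup (D.Glued N) := inferInstanceAs (AddCommGroup (∀ i, N i))

instance : Module S (D.Glued N) :=
  letI : ∀ i, Module S (N i) := fun i => Module.compHom (N i) (D.factor i).proj
  inferInstanceAs (Module S (∀ i, N i))

open Classical in
/-- The components of a glued module. -/
noncomputable def gluedComponents : D.Components (D.Glued N) N := fun i =>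
  { pr := Pi.evalAddMonoidHom N i
    inc := AddMonoidHom.single N i
    pr_inc := fun n => Pi.single_eq_same i n
    inc_pr := fun m => by
      funext j
      change Pi.single i (m i) j = (D.factor j).proj ((D.factor i).sec 1) • m j
      by_cases h : i = j
      · subst h
        rw [Pi.single_eq_same, RingFactor.proj_sec, one_smul]
      · rw [D.proj_sec_one i j h, zero_smul, Pi.single_eq_of_ne (Ne.symm h)]
    pr_smul := fun _ _ => rfl }

end Glued

variable {D}

theorem Components.isFlatMod {M : ModuleCat.{u} S} {N : ∀ i, ModuleCat.{u} (R i)}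
    (c : D.Components M (fun i => N i)) (h : ∀ i, IsFlatMod (R i) (N i)) : IsFlatMod S M := by
  intro A B _ _ _ _ f hf
  let cA := fun i => (D.factor i).op.partComponent A
  let cB := fun i => (D.factor i).op.partComponent B
  intro x y hxy
  rw [← D.sum_tensorInc_tensorPr cA c x, ← D.sum_tensorInc_tensorPr cA c y]
  refine Finset.sum_congr rfl fun i _ => congrArg _
    (h i _ _ ((cA i).map (cB i) f) ((cA i).map_injective (cB i) hf) ?_)
  rw [← (cA i).tensorPr_lmap (c i) (cB i) ((cA i).pr_apply (cB i) f),
    ← (cA i).tensorPr_lmap (c i) (cB i) ((cA i).pr_apply (cB i) f), hxy]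

theorem Components.isGorensteinFlat {M : ModuleCat.{u} S} {N : ∀ i, ModuleCat.{u} (R i)}
    (c : D.Components M (fun i => N i)) (h : ∀ i, IsGorensteinFlat (R i) (N i)) :
    IsGorensteinFlat S M := by
  choose X d hflat hex hN hten using h
  choose j hj hjd using fun i => (nonempty_equiv_range_iff (hex i 0)).1 (hN i)
  let cX := fun n => D.gluedComponents (fun i => X i n)
  have hex' := fun n => glue_exact (cX n) (cX (n + 1)) (cX (n + 1 + 1)) (fun i => hex i n)
  refine ⟨fun n => ModuleCat.of S (D.Glued fun i => X i n),
    fun n => glue (cX n) (cX (n + 1)) (fun i => d i n),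
    fun n => isFlatMod (M := ModuleCat.of S (D.Glued fun i => X i n)) (cX n)
      fun i => hflat i n, hex',
    (nonempty_equiv_range_iff (hex' 0)).2
      ⟨glue c (cX (0 + 1)) j, glue_injective _ _ hj, glue_exact _ _ _ hjd⟩, ?_⟩
  intro I _ _ hI n
  let b := fun i => (D.factor i).op.partComponent I
  exact Function.Exact.of_components
    (fun i => hten i _ ((b i).injective hI) n)
    (fun i => (b i).tensorPr (cX n i)) (fun i => (b i).tensorInc (cX n i))
    (fun i => (b i).tensorPr (cX (n + 1) i)) (fun i => (b i).tensorInc (cX (n + 1) i))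
    (fun i => (b i).tensorPr (cX (n + 1 + 1) i)) (fun i => (b i).tensorInc (cX (n + 1 + 1) i))
    (D.sum_tensorInc_tensorPr b (cX (n + 1))) (D.sum_tensorInc_tensorPr b (cX (n + 1 + 1)))
    (fun i => (b i).tensorPr_rmap _ _ (pr_glue (cX n) (cX (n + 1)) _ i))
    (fun i => (b i).rmap_tensorInc _ _ (glue_inc (cX n) (cX (n + 1)) _ i))
    (fun i => (b i).tensorPr_rmap _ _ (pr_glue (cX (n + 1)) (cX (n + 1 + 1)) _ i))

theorem Components.gflatDimLE {n : ℕ} {M : ModuleCat.{u} S} {N : ∀ i, ModuleCat.{u} (R i)}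
    (c : D.Components M (fun i => N i)) (h : ∀ i, gflatDimLE (R i) n (N i)) :
    gflatDimLE S n M := by
  induction n generalizing M N with
  | zero => exact c.isGorensteinFlat h
  | succ n ih =>
    choose K G i p hi hp hex hG hK using h
    let cK := D.gluedComponents (fun i => K i)
    let cG := D.gluedComponents (fun i => G i)
    exact ⟨ModuleCat.of S (D.Glued fun i => K i), ModuleCat.of S (D.Glued fun i => G i),
      glue cK cG i, glue cG c p, glue_injective cK cG hi, glue_surjective cG c hp,
      glue_exact cK cG c hex,
      isGorensteinFlat (M := ModuleCat.of S (D.Glued fun i => G i)) cG hG,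
      ih (M := ModuleCat.of S (D.Glued fun i => K i)) cK hK⟩

theorem gorensteinWeakGlobalDim_eq (D : RingDecomposition S R) :
    gorensteinWeakGlobalDim S = ⨆ i, gorensteinWeakGlobalDim (R i) := by
  refine le_antisymm ?_ (iSup_le fun i => (D.factor i).gorensteinWeakGlobalDim_le)
  induction h : ⨆ i, gorensteinWeakGlobalDim (R i) using ENat.recTopCoe with
  | top => exact le_top
  | coe n =>
    refine gorensteinWeakGlobalDim_le_natCast_iff.2 fun M =>
      Components.gflatDimLE (N := fun i => ModuleCat.of (R i) ((D.factor i).Part M))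
        (fun i => (D.factor i).partComponent M) fun i => ?_
    exact gorensteinWeakGlobalDim_le_natCast_iff.1
      ((le_iSup (fun i => gorensteinWeakGlobalDim (R i)) i).trans h.le) _

/-- The tautological decomposition of a finite product of rings. -/
def pi [DecidableEq ι] (R : ι → Type u) [∀ i, Ring (R i)] : RingDecomposition (∀ i, R i) R where
  factor i :=
    { proj := Pi.evalRingHom R i
      sec :=
        { toFun := Pi.single i
          map_mul' := Pi.single_mul i
          map_zero' := Pi.single_zero i
          map_add' := Pi.single_add i }
      proj_sec := Pi.single_eq_same i
      sec_proj := fun s => by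
        funext j
        change Pi.single i (s i) j = Pi.single (M := R) i 1 j * s j
        by_cases h : j = i
        · subst h
          simp
        · simp [h]
      sec_proj' := fun s => by
        funext j
        change Pi.single i (s i) j = s j * Pi.single (M := R) i 1 j
        by_cases h : j = i
        · subst h
          simp
        · simp [h] }
  sum_sec_one := Finset.univ_sum_single 1
  proj_sec_one i j h := Pi.single_eq_of_ne h.symm (1 : R i)

end RingDecomposition

/-- **Proposition 2.11.**  For any finite family of rings `R₁, …, R_m`,
`l.Gwdim(R₁ × ⋯ × R_m) = sup {l.Gwdim(R_i)}` and `r.Gwdim(R₁ × ⋯ × R_m) = sup {r.Gwdim(R_i)}`. -/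
theorem gorensteinWeakGlobalDim_pi (m : ℕ) (Rf : Fin m → Type u) [∀ i, Ring (Rf i)] :
    (gorensteinWeakGlobalDim (∀ i, Rf i) = ⨆ i, gorensteinWeakGlobalDim (Rf i)) ∧
    (gorensteinWeakGlobalDim (∀ i, Rf i)ᵐᵒᵖ = ⨆ i, gorensteinWeakGlobalDim (Rf i)ᵐᵒᵖ) :=
  ⟨(RingDecomposition.pi Rf).gorensteinWeakGlobalDim_eq,
    (RingDecomposition.pi Rf).op.gorensteinWeakGlobalDim_eq⟩
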